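/- Let A be a complex unital Banach algebra, m ≥ 1 an integer, e_1,…,e_m ∈ A, z ∈ ℂ∖{0} and v ∈ ℂ. Then the time-ordered exponential along the straight path u = tv, t ∈ [0,1], of the A-valued 1-form −(1/z)·Σ_{k=1}^m u^{k−1} e_k du equals Σ_{n≥0} (−1)^n z^{−n} Σ_{k_1,…,k_n ∈ {1,…,m}} e_{k_1} e_{k_2} ⋯ e_{k_n} · v^{k_1+⋯+k_n} / (k_1 · (k_1+k_2) ⋯ (k_1+⋯+k_n)), the series converging absolutely. In particular, all coefficients appearing in this expansion of the universal singular frame are rational numbers. -/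

import Mathlib

open MeasureTheory
noncomputable section

/-- The ordered simplex `{a ≤ s 0 ≤ s 1 ≤ ⋯ ≤ s (n-1) ≤ b}`. -/
def orderedSimplex (n : ℕ) (a b : ℝ) : Set (Fin n → ℝ) :=
  {s | (∀ i, s i ∈ Set.Icc a b) ∧ Monotone s}

/-- The time-ordered exponential (expansional)
`Te^{∫_a^b α(s)ds} = 1 + Σ_{n≥1} ∫_{a≤s_1≤⋯≤s_n≤b} α(s_1)⋯α(s_n) ds`. -/
def Texp {A : Type*} [NormedRing A] [NormedAlgebra ℂ A] [CompleteSpace A]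
    (α : ℝ → A) (a b : ℝ) : A :=
  ∑' n : ℕ, ∫ s in orderedSimplex n a b, (List.ofFn fun i => α (s i)).prod

theorem isCompact_orderedSimplex (n : ℕ) (a b : ℝ) : IsCompact (orderedSimplex n a b) := by
  have hpi : IsCompact (Set.univ.pi fun _ : Fin n => Set.Icc a b) :=
    isCompact_univ_pi fun _ => isCompact_Icc
  refine hpi.of_isClosed_subset ?_ fun s hs i _ => hs.1 i
  refine IsClosed.inter (s₁ := {s : Fin n → ℝ | ∀ i, s i ∈ Set.Icc a b}) ?_ isClosed_monotone
  simp only [Set.ofPred_forall]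
  exact isClosed_iInter fun i => isClosed_Icc.preimage (continuous_apply i)

theorem snoc_mem_orderedSimplex {n : ℕ} {a b t : ℝ} {s : Fin n → ℝ} :
    (Fin.snoc s t : Fin (n + 1) → ℝ) ∈ orderedSimplex (n + 1) a b ↔
      t ∈ Set.Icc a b ∧ s ∈ orderedSimplex n a t := by
  constructor
  · rintro ⟨h1, h2⟩
    have hl := h1 (Fin.last n)
    rw [Fin.snoc_last] at hl
    refine ⟨hl, fun i => ⟨?_, ?_⟩, fun i j hij => ?_⟩
    · simpa using (h1 i.castSucc).1
    · simpa using h2 (Fin.le_last i.castSucc)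
    · simpa using h2 (Fin.castSucc_le_castSucc_iff.2 hij)
  · rintro ⟨ht, h1, h2⟩
    refine ⟨fun i => ?_, fun i j hij => ?_⟩
    · induction i using Fin.lastCases with
      | last => simpa using ht
      | cast i => simpa using ⟨(h1 i).1, (h1 i).2.trans ht.2⟩
    · induction j using Fin.lastCases with
      | last =>
        induction i using Fin.lastCases with
        | last => exact le_rfl
        | cast i => simpa using (h1 i).2
      | cast j =>
        induction i using Fin.lastCases with
        | last => exact absurd hij (not_le.2 (Fin.castSucc_lt_last j))
        | cast i => simpa using h2 (Fin.castSucc_le_castSucc_iff.1 hij)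

/-- Iterated integration over the ordered simplex, the largest variable being outermost. -/
theorem setIntegral_orderedSimplex_succ {n : ℕ} {a b : ℝ} {F : (Fin (n + 1) → ℝ) → ℂ}
    (hF : Continuous F) :
    ∫ s in orderedSimplex (n + 1) a b, F s =
      ∫ t in Set.Icc a b, ∫ s in orderedSimplex n a t, F (Fin.snoc s t) := by
  have mp := (volume_preserving_piFinSuccAbove (fun _ : Fin (n + 1) => ℝ) (Fin.last n)).symm
  have hm : ∀ n b, MeasurableSet (orderedSimplex n a b) := fun n b =>
    (isCompact_orderedSimplex n a b).isClosed.measurableSet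
  have hint : Integrable ((orderedSimplex (n + 1) a b).indicator F) :=
    (hF.continuousOn.integrableOn_compact (isCompact_orderedSimplex _ a b)).integrable_indicator
      (hm _ _)
  have hint' := mp.integrable_comp_of_integrable hint
  rw [← integral_indicator (hm _ _), ← mp.integral_comp', ← integral_indicator measurableSet_Icc]
  rw [Measure.volume_eq_prod] at hint' ⊢
  refine (integral_prod _ hint').trans ?_
  congr 1
  ext t
  have key : ∀ s : Fin n → ℝ, (orderedSimplex (n + 1) a b).indicator F
      ((MeasurableEquiv.piFinSuccAbove (fun _ : Fin (n + 1) => ℝ) (Fin.last n)).symm (t, s)) =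
      (Set.Icc a b).indicator
        (fun t => (orderedSimplex n a t).indicator (fun s => F (Fin.snoc s t)) s) t := by
    intro s
    have : (MeasurableEquiv.piFinSuccAbove (fun _ : Fin (n + 1) => ℝ) (Fin.last n)).symm (t, s) =
        Fin.snoc s t := Fin.insertNth_last' t s
    rw [this]
    have hmem := snoc_mem_orderedSimplex (a := a) (b := b) (t := t) (s := s)
    by_cases ht : t ∈ Set.Icc a b
    · rw [Set.indicator_of_mem ht]
      by_cases hs : s ∈ orderedSimplex n a t
      · rw [Set.indicator_of_mem hs, Set.indicator_of_mem (hmem.2 ⟨ht, hs⟩)]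
      · rw [Set.indicator_of_notMem hs, Set.indicator_of_notMem fun h => hs (hmem.1 h).2]
    · rw [Set.indicator_of_notMem ht, Set.indicator_of_notMem fun h => ht (hmem.1 h).1]
  simp only [Function.comp_apply, key]
  by_cases ht : t ∈ Set.Icc a b
  · simp only [Set.indicator_of_mem ht, integral_indicator (hm _ _)]
  · simp only [Set.indicator_of_notMem ht, integral_zero]

theorem setIntegral_orderedSimplex_prod_pow {n : ℕ} (k : Fin n → ℕ) {b : ℝ} (hb : 0 ≤ b) :
    ∫ s in orderedSimplex n 0 b, ∏ i, (s i : ℂ) ^ k i =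
      (b : ℂ) ^ (∑ i, (k i + 1)) / ∏ i, ((∑ j ∈ Finset.Iic i, (k j + 1) : ℕ) : ℂ) := by
  induction n generalizing b with
  | zero =>
    have : orderedSimplex 0 0 b = Set.univ :=
      Set.eq_univ_of_forall fun s => ⟨fun i => i.elim0, fun i => i.elim0⟩
    simp [this, Measure.volume_pi_eq_dirac (0 : Fin 0 → ℝ)]
  | succ n ih =>
    rw [setIntegral_orderedSimplex_succ (by fun_prop)]
    set N : ℕ := ∑ i : Fin n, (k i.castSucc + 1) with hN
    set P : ℂ := ∏ i : Fin n, ((∑ j ∈ Finset.Iic i, (k j.castSucc + 1) : ℕ) : ℂ) with hP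
    have h1 : ∀ t ∈ Set.Icc 0 b, ∫ s in orderedSimplex n 0 t,
        ∏ i, ((Fin.snoc s t : Fin (n + 1) → ℝ) i : ℂ) ^ k i =
        (t : ℂ) ^ (N + k (Fin.last n)) / P := by
      intro t ht
      simp only [Fin.prod_univ_castSucc, Fin.snoc_castSucc, Fin.snoc_last]
      rw [integral_mul_const, ih (fun i => k i.castSucc) ht.1, pow_add]
      ring
    rw [setIntegral_congr_fun measurableSet_Icc h1, integral_Icc_eq_integral_Ioc,
      ← intervalIntegral.integral_of_le hb, intervalIntegral.integral_div]
    have h2 : ∫ t in (0 : ℝ)..b, (t : ℂ) ^ (N + k (Fin.last n)) =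
        (b : ℂ) ^ (N + (k (Fin.last n) + 1)) / ((N + (k (Fin.last n) + 1) : ℕ) : ℂ) := by
      have := congrArg (fun x : ℝ => (x : ℂ))
        (integral_pow (a := 0) (b := b) (N + k (Fin.last n)))
      simp only [← intervalIntegral.integral_ofReal] at this
      push_cast at this ⊢
      rw [this]
      simp [add_assoc]
    have hlast : Finset.Iic (Fin.last n) = Finset.univ := by
      ext i
      simp [Fin.le_last]
    rw [h2, Fin.prod_univ_castSucc, hlast, Fin.sum_univ_castSucc]
    simp only [Fin.sum_Iic_castSucc]
    rw [← hN, ← hP, div_div, mul_comm P]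

theorem prod_ofFn_sum_smul {A ι : Type*} [Ring A] [Algebra ℂ A] [Fintype ι] (e : ι → A) (n : ℕ)
    (c : Fin n → ι → ℂ) :
    (List.ofFn fun i => ∑ j, c i j • e j).prod =
      ∑ k : Fin n → ι, (∏ i, c i (k i)) • (List.ofFn fun i => e (k i)).prod := by
  induction n with
  | zero => simp
  | succ n ih =>
    rw [List.ofFn_succ, List.prod_cons, ih fun i => c i.succ,
      ← (Fin.consEquiv fun _ => ι).sum_comp, Fintype.sum_prod_type, Finset.sum_mul_sum]
    refine Finset.sum_congr rfl fun j _ => Finset.sum_congr rfl fun k _ => ?_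
    rw [smul_mul_smul_comm]
    simp [Fin.consEquiv, Fin.prod_univ_succ]

theorem factorial_le_norm_prod_sum_Iic {n : ℕ} (k : Fin n → ℕ) :
    (n.factorial : ℝ) ≤ ‖∏ i, ((∑ j ∈ Finset.Iic i, (k j + 1) : ℕ) : ℂ)‖ := by
  rw [← Finset.prod_range_add_one_eq_factorial, ← Fin.prod_univ_eq_prod_range, norm_prod]
  push_cast [← Nat.cast_prod]
  simp only [← Nat.cast_add_one, ← Nat.cast_sum, Complex.norm_natCast]
  refine Finset.prod_le_prod (fun i _ => by positivity) fun i _ => ?_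
  norm_cast
  calc (i : ℕ) + 1 = ∑ j ∈ Finset.Iic i, 1 := by simp
    _ ≤ _ := Finset.sum_le_sum fun j _ => by omega

theorem summable_norm_singularFrame {A : Type*} [NormedRing A] [NormOneClass A]
    [NormedAlgebra ℂ A] {m : ℕ} (e : Fin m → A) (w v : ℂ) :
    Summable (fun n : ℕ =>
      ‖∑ k : Fin n → Fin m,
        (((-1 : ℂ) ^ n * w ^ n * v ^ (∑ i, ((k i : ℕ) + 1)) /
            ∏ i, ((∑ j ∈ Finset.Iic i, ((k j : ℕ) + 1) : ℕ) : ℂ)) •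
          (List.ofFn fun i => e (k i)).prod)‖) := by
  refine Summable.of_nonneg_of_le (fun _ => norm_nonneg _) (fun n => ?_)
    (Real.summable_pow_div_factorial (∑ j : Fin m, ‖w‖ * ‖v‖ ^ ((j : ℕ) + 1) * ‖e j‖))
  rw [Fintype.sum_pow, Finset.sum_div]
  refine norm_sum_le_of_le _ fun k _ => ?_
  have hprod : ‖(List.ofFn fun i => e (k i)).prod‖ ≤ ∏ i, ‖e (k i)‖ := by
    refine (List.norm_prod_le _).trans_eq ?_
    rw [List.map_ofFn, List.prod_ofFn]
    rfl
  have hfac := factorial_le_norm_prod_sum_Iic fun i => (k i : ℕ)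
  have hpos : (0 : ℝ) < n.factorial := by positivity
  rw [norm_smul, norm_div]
  have hnum : ‖(-1 : ℂ) ^ n * w ^ n * v ^ (∑ i, ((k i : ℕ) + 1))‖ =
      ∏ i : Fin n, (‖w‖ * ‖v‖ ^ ((k i : ℕ) + 1)) := by
    simp [Finset.prod_mul_distrib, Finset.prod_pow_eq_pow_sum]
  rw [Finset.prod_mul_distrib (g := fun i => ‖e (k i)‖), ← hnum, mul_div_right_comm]
  gcongr

/-- The expansion of the universal singular frame: the time-ordered exponential
along the straight path `u = tv`, `t ∈ [0,1]`, of the 1-form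
`−(1/z)·Σ_{k=1}^m u^{k−1} e_k du` (here the index `k ∈ {1,…,m}` is represented by
`k : Fin m` with value `(k:ℕ)+1`, and the pullback of the form along the path is
`t ↦ Σ_k −(1/z)(tv)^{k−1} e_k · v`) equals
`Σ_{n≥0} (−1)^n z^{−n} Σ_{k_1,…,k_n} e_{k_1}⋯e_{k_n} v^{Σk_j}/(k_1(k_1+k_2)⋯(k_1+⋯+k_n))`,
the series converging absolutely; in particular all coefficients are rational. -/
theorem stmt4 {A : Type*} [NormedRing A] [NormOneClass A] [NormedAlgebra ℂ A]
    [CompleteSpace A] (m : ℕ) (hm : 1 ≤ m) (e : Fin m → A) (z : ℂ) (hz : z ≠ 0)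
    (v : ℂ) :
    Summable (fun n : ℕ =>
      ‖∑ k : Fin n → Fin m,
        (((-1 : ℂ) ^ n * (z⁻¹) ^ n *
            v ^ (∑ i, ((k i : ℕ) + 1)) /
            ∏ i, ((∑ j ∈ Finset.Iic i, ((k j : ℕ) + 1) : ℕ) : ℂ)) •
          (List.ofFn fun i => e (k i)).prod)‖) ∧
    Texp (fun t : ℝ => ∑ j : Fin m, (-(z⁻¹) * ((t : ℂ) * v) ^ (j : ℕ) * v) • e j) 0 1 =
      ∑' n : ℕ, ∑ k : Fin n → Fin m,
        (((-1 : ℂ) ^ n * (z⁻¹) ^ n *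
            v ^ (∑ i, ((k i : ℕ) + 1)) /
            ∏ i, ((∑ j ∈ Finset.Iic i, ((k j : ℕ) + 1) : ℕ) : ℂ)) •
          (List.ofFn fun i => e (k i)).prod) := by
  refine ⟨summable_norm_singularFrame e z⁻¹ v, tsum_congr fun n => ?_⟩
  simp only [prod_ofFn_sum_smul]
  have hc : ∀ k : Fin n → Fin m, ∀ s : Fin n → ℝ,
      ∏ i, (-(z⁻¹) * ((s i : ℂ) * v) ^ (k i : ℕ) * v) =
        ((-1 : ℂ) ^ n * (z⁻¹) ^ n * v ^ (∑ i, ((k i : ℕ) + 1))) *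
          ∏ i, (s i : ℂ) ^ (k i : ℕ) := by
    intro k s
    rw [← Finset.prod_pow_eq_pow_sum, ← mul_pow, ← Fin.prod_const, ← Finset.prod_mul_distrib,
      ← Finset.prod_mul_distrib]
    exact Finset.prod_congr rfl fun i _ => by ring
  rw [integral_finsetSum]
  · refine Finset.sum_congr rfl fun k _ => ?_
    rw [integral_smul_const]
    simp only [hc]
    rw [integral_const_mul,
      setIntegral_orderedSimplex_prod_pow (fun i => (k i : ℕ)) zero_le_one]
    rw [Complex.ofReal_one, one_pow, mul_one_div]
  · intro k _
    exact (Continuous.continuousOn (by fun_prop)).integrableOn_compact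
      (isCompact_orderedSimplex n 0 1)
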